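/- (Myrheim–Meyer flat dimension estimator.) Let n ≥ 2 be an integer and T > 0. The Lebesgue measure (on ℝ^n × ℝ^n) of the set of relations { (x₁,x₂) : p ⪯ x₁ ⪯ x₂ ⪯ q } divided by V₀², where V₀ is the Lebesgue volume of I[p,q], equals 𝖿₀(n) = Γ(n+1)·Γ(n/2) / ( 4·Γ(3n/2) ); this ratio depends only on the dimension n. -/

import Mathlib

open MeasureTheory

/-- A point of `n`-dimensional Minkowski space: a time coordinate in `ℝ`
and a spatial part in `ℝ^{n-1}` (with the Euclidean norm). -/
abbrev MinkPt (n : ℕ) := ℝ × EuclideanSpace ℝ (Fin (n - 1))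

/-- The Minkowski causal order: `x ⪯ y` iff `y⁰ - x⁰ ≥ ‖y⃗ - x⃗‖`. -/
def causalLE {n : ℕ} (x y : MinkPt n) : Prop := ‖y.2 - x.2‖ ≤ y.1 - x.1

/-- The bottom tip `p = (-T/2, 0)` of the causal diamond. -/
noncomputable def pDiam (n : ℕ) (T : ℝ) : MinkPt n := (-(T / 2), 0)

/-- The top tip `q = (T/2, 0)` of the causal diamond. -/
noncomputable def qDiam (n : ℕ) (T : ℝ) : MinkPt n := (T / 2, 0)

/-- The Alexandrov interval (causal diamond) `I[p,q] = {x : p ⪯ x ⪯ q}`. -/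
def diamond (n : ℕ) (T : ℝ) : Set (MinkPt n) :=
  {x | causalLE (pDiam n T) x ∧ causalLE x (qDiam n T)}

/-- The surface area `A_{d} = 2π^{(d+1)/2}/Γ((d+1)/2)` of the unit sphere `S^{d} ⊂ ℝ^{d+1}`;
here we take `d = n - 2`, so `A_{n-2} = 2π^{(n-1)/2}/Γ((n-1)/2)`. -/
noncomputable def sphereArea (n : ℕ) : ℝ :=
  2 * Real.pi ^ (((n : ℝ) - 1) / 2) / Real.Gamma (((n : ℝ) - 1) / 2)

section CausalDiamond

open Set

/-- Integration of a radial function in polar coordinates. -/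
lemma lintegral_fun_norm_addHaar {E : Type*} [NormedAddCommGroup E] [NormedSpace ℝ E]
    [MeasurableSpace E] [BorelSpace E] [FiniteDimensional ℝ E] [Nontrivial E]
    (μ : Measure E) [μ.IsAddHaarMeasure] {f : ℝ → ENNReal} (hf : Measurable f) :
    ∫⁻ x, f ‖x‖ ∂μ = μ.toSphere univ *
      ∫⁻ r in Ioi (0 : ℝ), ENNReal.ofReal (r ^ (Module.finrank ℝ E - 1)) * f r := by
  have h1 : ∫⁻ x, f ‖x‖ ∂μ = ∫⁻ x : ({0}ᶜ : Set E), f ‖x.1‖ ∂(μ.comap (↑)) := by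
    rw [lintegral_subtype_comap (measurableSet_singleton _).compl (fun x => f ‖x‖),
      restrict_compl_singleton]
  have h2 := μ.measurePreserving_homeomorphUnitSphereProd.lintegral_comp_emb
    (Homeomorph.measurableEmbedding _) (f ∘ (↑) ∘ Prod.snd)
  simp only [Function.comp_def, homeomorphUnitSphereProd_apply_snd_coe] at h2
  rw [h1, h2, lintegral_prod _ (by fun_prop)]
  simp only [lintegral_const]
  rw [mul_comm]
  congr 1
  rw [Measure.volumeIoiPow, lintegral_withDensity_eq_lintegral_mul _ (by fun_prop) (by fun_prop)]
  exact lintegral_subtype_comap measurableSet_Ioi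
    (fun r : ℝ => ENNReal.ofReal (r ^ (Module.finrank ℝ E - 1)) * f r)

/-- Scaling the variable of a Lebesgue integral on the line. -/
lemma lintegral_eq_ofReal_mul_lintegral_comp_mul (f : ℝ → ENNReal) {a : ℝ} (ha : 0 < a) :
    ∫⁻ x, f x = ENNReal.ofReal a * ∫⁻ x, f (a * x) := by
  have h := (Homeomorph.mulLeft₀ a ha.ne').measurableEmbedding.lintegral_map (μ := volume) f
  have h' := Real.smul_map_volume_mul_left ha.ne'
  rw [abs_of_pos ha] at h'
  conv_lhs => rw [← h', lintegral_smul_measure]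
  exact congrArg _ h

lemma lintegral_Ioo_rpow_mul_pow {s : ℝ} (hs : 0 ≤ s) (k : ℕ) :
    ∫⁻ w in Ioo (0 : ℝ) 1, ENNReal.ofReal (w ^ s * (1 - w) ^ k) =
      ENNReal.ofReal (ProbabilityTheory.beta (s + 1) (k + 1)) := by
  have hb : 0 < ProbabilityTheory.beta (s + 1) (k + 1) :=
    ProbabilityTheory.beta_pos (by positivity) (by positivity)
  have h := ProbabilityTheory.lintegral_betaPDF_eq_one (α := s + 1) (β := k + 1)
    (by positivity) (by positivity)
  rw [ProbabilityTheory.lintegral_betaPDF] at h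
  simp only [add_sub_cancel_right, Real.rpow_natCast, mul_assoc,
    ENNReal.ofReal_mul (one_div_pos.2 hb).le] at h
  rw [lintegral_const_mul _ (by fun_prop)] at h
  calc _ = ENNReal.ofReal (ProbabilityTheory.beta (s + 1) (k + 1) *
          (1 / ProbabilityTheory.beta (s + 1) (k + 1))) *
        ∫⁻ w in Ioo (0 : ℝ) 1, ENNReal.ofReal (w ^ s * (1 - w) ^ k) := by
        rw [mul_one_div_cancel hb.ne', ENNReal.ofReal_one, one_mul]
    _ = _ := by rw [ENNReal.ofReal_mul hb.le, mul_assoc, h, mul_one]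

lemma lintegral_Ioc_rpow {b T : ℝ} (hb : 0 ≤ b) (hT : 0 ≤ T) :
    ∫⁻ u in Ioc 0 T, ENNReal.ofReal (u ^ b) = ENNReal.ofReal (T ^ (b + 1) / (b + 1)) := by
  rw [← ofReal_integral_eq_lintegral_ofReal]
  · rw [← intervalIntegral.integral_of_le hT, integral_rpow (Or.inl (by linarith)),
      Real.zero_rpow (by linarith), sub_zero]
  · exact (intervalIntegral.intervalIntegrable_rpow' (by linarith)).1
  · filter_upwards [ae_restrict_mem measurableSet_Ioc] with u hu
    exact Real.rpow_nonneg hu.1.le _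

open Classical in
/-- The integrand of `τ ^ (2 * s)` over a causal diamond of height `T`, in the time
coordinate `t` and the radius `r`. -/
noncomputable def polarIntegrand (k : ℕ) (s T t r : ℝ) : ENNReal :=
  if 0 < r ∧ r ≤ t ∧ r ≤ T - t then ENNReal.ofReal (r ^ k * (t ^ 2 - r ^ 2) ^ s) else 0

lemma measurable_polarIntegrand (k : ℕ) (s T : ℝ) :
    Measurable fun x : ℝ × ℝ => polarIntegrand k s T x.1 x.2 := by
  unfold polarIntegrand
  refine Measurable.ite ?_ (by fun_prop) measurable_const
  exact (measurableSet_lt measurable_const measurable_snd).inter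
    ((measurableSet_le measurable_snd measurable_fst).inter
      (measurableSet_le measurable_snd (measurable_const.sub measurable_fst)))

lemma lintegral_polarIntegrand_lightcone {s : ℝ} (hs : 0 ≤ s) (k : ℕ) (T : ℝ) {u : ℝ} :
    ∫⁻ v, polarIntegrand k s T ((v + u) / 2) ((u - v) / 2) =
      (Ioc 0 T).indicator (fun u => ENNReal.ofReal (u ^ (2 * s + k + 1)) *
        ENNReal.ofReal ((1 / 2) ^ k * ProbabilityTheory.beta (s + 1) (k + 1))) u := by
  by_cases hu : u ∈ Ioc 0 T
  · have hu0 := hu.1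
    have huT := hu.2
    rw [indicator_of_mem hu, lintegral_eq_ofReal_mul_lintegral_comp_mul _ hu.1]
    have h : ∀ w, polarIntegrand k s T ((u * w + u) / 2) ((u - u * w) / 2) =
        (Ico 0 1).indicator (fun w => ENNReal.ofReal (u ^ (2 * s + k) * (1 / 2) ^ k) *
          ENNReal.ofReal (w ^ s * (1 - w) ^ k)) w := by
      intro w
      rw [polarIntegrand, indicator_apply]
      have e : (0 < (u - u * w) / 2 ∧ (u - u * w) / 2 ≤ (u * w + u) / 2 ∧
          (u - u * w) / 2 ≤ T - (u * w + u) / 2) ↔ w ∈ Ico (0 : ℝ) 1 := by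
        constructor
        · rintro ⟨h1, h2, h3⟩
          constructor <;> by_contra! h <;> nlinarith
        · rintro ⟨h1, h2⟩
          refine ⟨?_, ?_, ?_⟩ <;> nlinarith [mul_nonneg hu0.le h1]
      simp only [e]
      split_ifs with hw
      · rw [← ENNReal.ofReal_mul (by positivity)]
        congr 1
        have : ((u * w + u) / 2) ^ 2 - ((u - u * w) / 2) ^ 2 = u ^ 2 * w := by ring
        rw [this, Real.mul_rpow (by positivity) hw.1, Real.rpow_add hu0, Real.rpow_mul hu0.le,
          Real.rpow_natCast, Real.rpow_two, show (u - u * w) / 2 = u * (1 / 2) * (1 - w) by ring,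
          mul_pow, mul_pow]
        ring
      · rfl
    simp_rw [h]
    rw [lintegral_indicator measurableSet_Ico, setLIntegral_congr Ioo_ae_eq_Ico.symm,
      lintegral_const_mul _ (by fun_prop), lintegral_Ioo_rpow_mul_pow hs,
      ← ENNReal.ofReal_mul (by positivity), ← ENNReal.ofReal_mul (by positivity),
      ← ENNReal.ofReal_mul (by positivity), Real.rpow_add_one hu0.ne']
    congr 1
    ring
  · rw [indicator_of_notMem hu]
    refine lintegral_eq_zero_of_ae_eq_zero (.of_forall fun v => ?_)
    refine if_neg ?_
    · rintro ⟨h1, h2, h3⟩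
      exact hu ⟨by linarith, by linarith⟩

/-- The integral of `τ ^ (2 * s)` over the diamond of height `T` in dimension `k + 2`, up to the
area of the unit sphere. -/
noncomputable def diamondMoment (k : ℕ) (s T : ℝ) : ℝ :=
  (1 / 2) ^ (k + 1) * ProbabilityTheory.beta (s + 1) (k + 1) *
    (T ^ (2 * s + k + 2) / (2 * s + k + 2))

lemma lintegral_polarIntegrand {s T : ℝ} (hs : 0 ≤ s) (hT : 0 ≤ T) (k : ℕ) :
    ∫⁻ r, ∫⁻ t, polarIntegrand k s T t r = ENNReal.ofReal (diamondMoment k s T) := by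
  have hm := measurable_polarIntegrand k s T
  have hb : 0 ≤ ProbabilityTheory.beta (s + 1) (k + 1) :=
    (ProbabilityTheory.beta_pos (by positivity) (by positivity)).le
  calc ∫⁻ r, ∫⁻ t, polarIntegrand k s T t r
      = ∫⁻ r, ∫⁻ v, polarIntegrand k s T (v + r) r := by
        refine lintegral_congr fun r => ?_
        rw [lintegral_add_right_eq_self (fun t => polarIntegrand k s T t r)]
    _ = ∫⁻ v, ∫⁻ r, polarIntegrand k s T (v + r) r := by
        refine lintegral_lintegral_swap (Measurable.aemeasurable ?_)
        exact hm.comp (f := fun x : ℝ × ℝ => (x.2 + x.1, x.1)) (by fun_prop)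
    _ = ∫⁻ v, ENNReal.ofReal (1 / 2) * ∫⁻ u,
          polarIntegrand k s T ((v + u) / 2) ((u - v) / 2) := by
        refine lintegral_congr fun v => ?_
        rw [lintegral_eq_ofReal_mul_lintegral_comp_mul _ (one_half_pos (α := ℝ)),
          ← lintegral_sub_right_eq_self _ v]
        congr 1
        refine lintegral_congr fun u => ?_
        congr 1 <;> ring
    _ = ENNReal.ofReal (1 / 2) * ∫⁻ u, ∫⁻ v,
          polarIntegrand k s T ((v + u) / 2) ((u - v) / 2) := by
        have hm' : Measurable fun x : ℝ × ℝ =>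
            polarIntegrand k s T ((x.1 + x.2) / 2) ((x.2 - x.1) / 2) :=
          hm.comp (f := fun x : ℝ × ℝ => ((x.1 + x.2) / 2, (x.2 - x.1) / 2)) (by fun_prop)
        rw [lintegral_const_mul _ hm'.lintegral_prod_right',
          lintegral_lintegral_swap hm'.aemeasurable]
    _ = _ := by
        simp_rw [lintegral_polarIntegrand_lightcone hs]
        rw [lintegral_indicator measurableSet_Ioc, lintegral_mul_const _ (by fun_prop),
          lintegral_Ioc_rpow (by positivity) hT, ← ENNReal.ofReal_mul (by positivity),
          ← ENNReal.ofReal_mul (by positivity), diamondMoment,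
          show 2 * s + (k : ℝ) + 1 + 1 = 2 * s + k + 2 by ring]
        congr 1
        ring

lemma diamondMoment_eq_mul_rpow (k : ℕ) (s T : ℝ) :
    diamondMoment k s T = diamondMoment k s 1 * T ^ (2 * s + k + 2) := by
  simp only [diamondMoment, Real.one_rpow]
  ring

lemma diamondMoment_zero (k : ℕ) (T : ℝ) :
    diamondMoment k 0 T = diamondMoment k 0 1 * T ^ (k + 2) := by
  rw [diamondMoment_eq_mul_rpow, ← Real.rpow_natCast T]
  congr 2
  push_cast
  ring

lemma diamondMoment_pos (k : ℕ) {s T : ℝ} (hs : 0 ≤ s) (hT : 0 < T) :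
    0 < diamondMoment k s T := by
  have := ProbabilityTheory.beta_pos (α := s + 1) (β := k + 1) (by positivity) (by positivity)
  unfold diamondMoment
  positivity

lemma diamondMoment_ratio (k : ℕ) {T : ℝ} (hT : 0 < T) :
    diamondMoment k 0 1 * diamondMoment k (((k + 1 : ℕ) + 1) / 2) T / diamondMoment k 0 T ^ 2 =
      Real.Gamma (((k + 2 : ℕ) : ℝ) + 1) * Real.Gamma (((k + 2 : ℕ) : ℝ) / 2) /
        (4 * Real.Gamma (3 * ((k + 2 : ℕ) : ℝ) / 2)) := by
  have hp : T ^ (2 * ((((k + 1 : ℕ) : ℝ) + 1) / 2) + k + 2) = (T ^ (k + 2)) ^ 2 := by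
    rw [← pow_mul, ← Real.rpow_natCast]
    congr 1
    push_cast
    ring
  rw [diamondMoment_zero k T, diamondMoment_eq_mul_rpow k _ T, hp]
  simp only [diamondMoment, ProbabilityTheory.beta, Real.one_rpow]
  push_cast
  have hk : (0 : ℝ) < k + 1 := by positivity
  have e1 : Real.Gamma ((k : ℝ) + 2 + 1) = (k + 2) * ((k + 1) * Real.Gamma (k + 1)) := by
    rw [Real.Gamma_add_one (by positivity), show (k : ℝ) + 2 = k + 1 + 1 by ring,
      Real.Gamma_add_one hk.ne']
  have e2 : Real.Gamma (((k : ℝ) + 1 + 1) / 2 + 1) =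
      (k + 2) / 2 * Real.Gamma ((k + 2) / 2) := by
    rw [Real.Gamma_add_one (by positivity), show (k : ℝ) + 1 + 1 = k + 2 by ring]
  have e3 : Real.Gamma ((0 : ℝ) + 1 + (k + 1)) = (k + 1) * Real.Gamma (k + 1) := by
    rw [zero_add, add_comm, Real.Gamma_add_one hk.ne']
  have e4 : ((k : ℝ) + 1 + 1) / 2 + 1 + (k + 1) = 3 * (k + 2) / 2 := by ring
  rw [e1, e2, e3, e4, zero_add, Real.Gamma_one]
  have g1 := Real.Gamma_pos_of_pos hk
  have g2 : 0 < Real.Gamma (((k : ℝ) + 2) / 2) := Real.Gamma_pos_of_pos (by positivity)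
  have g3 : 0 < Real.Gamma (3 * ((k : ℝ) + 2) / 2) := Real.Gamma_pos_of_pos (by positivity)
  field_simp
  ring

section Minkowski

variable {E : Type*} [NormedAddCommGroup E]

/-- The causal future of the origin in the Minkowski space `ℝ × E`. -/
def futureCone (E : Type*) [NormedAddCommGroup E] : Set (ℝ × E) := {x | ‖x.2‖ ≤ x.1}

/-- The squared Minkowski length of a vector. -/
def minkSq (x : ℝ × E) : ℝ := x.1 ^ 2 - ‖x.2‖ ^ 2

/-- The causal diamond with tips `0` and `d`. -/
def tipDiamond (d : ℝ × E) : Set (ℝ × E) := {y | y ∈ futureCone E ∧ d - y ∈ futureCone E}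

lemma minkSq_pos {w : ℝ × E} (hw : ‖w.2‖ < w.1) : 0 < minkSq w := by
  have := norm_nonneg w.2
  unfold minkSq
  nlinarith

lemma minkSq_nonneg {w : ℝ × E} (hw : w ∈ futureCone E) : 0 ≤ minkSq w := by
  have := norm_nonneg w.2
  have hw : ‖w.2‖ ≤ w.1 := hw
  unfold minkSq
  nlinarith

lemma mem_futureCone_iff {x : ℝ × E} : x ∈ futureCone E ↔ 0 ≤ x.1 ∧ 0 ≤ minkSq x := by
  refine ⟨fun h => ⟨(norm_nonneg _).trans h, minkSq_nonneg h⟩, fun h => ?_⟩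
  exact abs_le_of_sq_le_sq' (by have := h.2; unfold minkSq at this; linarith) h.1 |>.2

lemma add_mem_futureCone {x y : ℝ × E} (hx : x ∈ futureCone E) (hy : y ∈ futureCone E) :
    x + y ∈ futureCone E :=
  (norm_add_le _ _).trans (add_le_add hx hy)

lemma isClosed_futureCone : IsClosed (futureCone E) :=
  isClosed_le (by fun_prop) (by fun_prop)

variable [InnerProductSpace ℝ E]

/-- The Lorentz transformation of `ℝ × E` that fixes `w` and is `-1` on the Minkowski complement
of `w`. -/
noncomputable def lorentzInvolution (w : ℝ × E) : (ℝ × E) →ₗ[ℝ] (ℝ × E) :=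
  (((2 / minkSq w) • (w.1 • LinearMap.fst ℝ ℝ E -
    (innerₛₗ ℝ w.2).comp (LinearMap.snd ℝ ℝ E))).smulRight w) - LinearMap.id

lemma lorentzInvolution_apply (w x : ℝ × E) : lorentzInvolution w x =
    (2 / minkSq w * (w.1 * x.1 - inner ℝ w.2 x.2)) • w - x := by
  simp [lorentzInvolution]

lemma lorentzInvolution_lorentzInvolution {w : ℝ × E} (hw : minkSq w ≠ 0) (x : ℝ × E) :
    lorentzInvolution w (lorentzInvolution w x) = x := by
  have h : w.1 * (lorentzInvolution w x).1 - inner ℝ w.2 (lorentzInvolution w x).2 =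
      w.1 * x.1 - inner ℝ w.2 x.2 := by
    rw [lorentzInvolution_apply]
    simp only [Prod.fst_sub, Prod.smul_fst, Prod.snd_sub, Prod.smul_snd, inner_sub_right,
      inner_smul_right, real_inner_self_eq_norm_sq, smul_eq_mul]
    have : minkSq w = w.1 ^ 2 - ‖w.2‖ ^ 2 := rfl
    field_simp
    rw [this]
    ring
  rw [lorentzInvolution_apply, h, lorentzInvolution_apply, sub_sub_cancel]

lemma minkSq_lorentzInvolution {w : ℝ × E} (hw : minkSq w ≠ 0) (x : ℝ × E) :
    minkSq (lorentzInvolution w x) = minkSq x := by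
  rw [lorentzInvolution_apply]
  have h : ∀ c : ℝ, minkSq (c • w - x) =
      c ^ 2 * minkSq w - 2 * c * (w.1 * x.1 - inner ℝ w.2 x.2) + minkSq x := by
    intro c
    simp only [minkSq, Prod.fst_sub, Prod.smul_fst, Prod.snd_sub, Prod.smul_snd,
      norm_sub_sq_real, norm_smul, inner_smul_left, smul_eq_mul, mul_pow, Real.norm_eq_abs, sq_abs,
      conj_trivial]
    ring
  rw [h]
  field_simp
  ring

lemma lorentzInvolution_mem_futureCone {w x : ℝ × E} (hw : ‖w.2‖ < w.1) (hx : x ∈ futureCone E) :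
    lorentzInvolution w x ∈ futureCone E := by
  have hw' := minkSq_pos hw
  rw [mem_futureCone_iff, minkSq_lorentzInvolution hw'.ne']
  refine ⟨?_, minkSq_nonneg hx⟩
  have hx' : ‖x.2‖ ≤ x.1 := hx
  have h1 := real_inner_le_norm w.2 x.2
  have h2 := norm_nonneg w.2
  have h3 := norm_nonneg x.2
  rw [lorentzInvolution_apply]
  simp only [Prod.fst_sub, Prod.smul_fst, smul_eq_mul]
  rw [div_mul_eq_mul_div, div_mul_eq_mul_div, sub_nonneg, le_div_iff₀ hw', minkSq]
  have h4 : inner ℝ w.2 x.2 ≤ ‖w.2‖ * x.1 := h1.trans (by gcongr)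
  nlinarith [mul_nonneg (h3.trans hx') (sq_nonneg (w.1 - ‖w.2‖)),
    mul_le_mul_of_nonneg_left h4 (h2.trans hw.le)]

lemma lorentzInvolution_mem_futureCone_iff {w x : ℝ × E} (hw : ‖w.2‖ < w.1) :
    lorentzInvolution w x ∈ futureCone E ↔ x ∈ futureCone E := by
  refine ⟨fun h => ?_, lorentzInvolution_mem_futureCone hw⟩
  rw [← lorentzInvolution_lorentzInvolution (minkSq_pos hw).ne' x]
  exact lorentzInvolution_mem_futureCone hw h

/-- The involution with axis `d + (τ, 0)` sends `d` to the vector `(τ, 0)` of the same length. -/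
lemma lorentzInvolution_axis {d : ℝ × E} (hd : ‖d.2‖ < d.1) :
    lorentzInvolution (d + (√(minkSq d), 0)) d = (√(minkSq d), 0) := by
  have hd' := minkSq_pos hd
  have hτ : 0 < √(minkSq d) := Real.sqrt_pos.2 hd'
  have hsq : √(minkSq d) ^ 2 = minkSq d := Real.sq_sqrt hd'.le
  set τ := √(minkSq d)
  have hd1 : 0 < d.1 := (norm_nonneg _).trans_lt hd
  have h : minkSq (d + (τ, 0)) = 2 * (τ ^ 2 + τ * d.1) := by
    rw [hsq]
    simp only [minkSq, Prod.fst_add, Prod.snd_add, add_zero] at hsq ⊢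
    linear_combination hsq
  have h' : (d + (τ, 0)).1 * d.1 - inner ℝ (d + (τ, 0)).2 d.2 = τ ^ 2 + τ * d.1 := by
    rw [hsq]
    simp only [minkSq, Prod.fst_add, Prod.snd_add, add_zero, real_inner_self_eq_norm_sq]
    ring
  have : τ ^ 2 + τ * d.1 ≠ 0 := by positivity
  rw [lorentzInvolution_apply, h, h']
  have e : 2 / (2 * (τ ^ 2 + τ * d.1)) * (τ ^ 2 + τ * d.1) = 1 := by field_simp
  rw [e, one_smul, add_sub_cancel_left]

variable [MeasureSpace E] [BorelSpace E] [FiniteDimensional ℝ E]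

lemma measurableSet_tipDiamond (d : ℝ × E) : MeasurableSet (tipDiamond d) := by
  refine (isClosed_futureCone.inter (isClosed_futureCone.preimage ?_)).measurableSet
  fun_prop

variable [(volume : Measure E).IsAddHaarMeasure]

lemma volume_preimage_lorentzInvolution {w : ℝ × E} (hw : minkSq w ≠ 0) (s : Set (ℝ × E)) :
    volume (lorentzInvolution w ⁻¹' s) = volume s := by
  have h : LinearMap.det (lorentzInvolution w) * LinearMap.det (lorentzInvolution w) = 1 := by
    rw [← LinearMap.det_comp, ← LinearMap.det_id (A := ℝ) (M := ℝ × E)]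
    congr 1
    ext1 <;> ext1 <;> simp [lorentzInvolution_lorentzInvolution hw]
  have h0 : LinearMap.det (lorentzInvolution w) ≠ 0 := left_ne_zero_of_mul_eq_one h
  have h1 : |(LinearMap.det (lorentzInvolution w))⁻¹| = 1 := by
    rw [abs_inv]
    rcases mul_self_eq_one_iff.1 h with h | h <;> simp [h]
  have : (volume : Measure (ℝ × E)).IsAddHaarMeasure :=
    inferInstanceAs ((volume : Measure ℝ).prod (volume : Measure E)).IsAddHaarMeasure
  rw [Measure.addHaar_preimage_linearMap _ h0, h1, ENNReal.ofReal_one, one_mul]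

/-- Lorentz invariance of the volume of a causal diamond. -/
lemma volume_tipDiamond {d : ℝ × E} (hd : ‖d.2‖ < d.1) :
    volume (tipDiamond d) = volume (tipDiamond ((√(minkSq d), 0) : ℝ × E)) := by
  have hτ := Real.sqrt_nonneg (minkSq d)
  have hw : ‖(d + (√(minkSq d), 0)).2‖ < (d + (√(minkSq d), 0)).1 := by
    simp only [Prod.fst_add, Prod.snd_add, add_zero]
    linarith
  rw [← volume_preimage_lorentzInvolution (minkSq_pos hw).ne' (tipDiamond (√(minkSq d), 0))]
  congr 1
  ext y
  have h := lorentzInvolution_mem_futureCone_iff hw (x := d - y)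
  rw [map_sub, lorentzInvolution_axis hd] at h
  exact (and_congr (lorentzInvolution_mem_futureCone_iff hw) h).symm

lemma ae_norm_ne_fst : ∀ᵐ x : ℝ × E, ‖x.2‖ ≠ x.1 := by
  have hm : MeasurableSet {x : ℝ × E | ‖x.2‖ = x.1} :=
    measurableSet_eq_fun (by fun_prop) (by fun_prop)
  rw [ae_iff]
  simp only [ne_eq, not_not]
  rw [Measure.volume_eq_prod, Measure.prod_apply_symm hm]
  refine lintegral_eq_zero_of_ae_eq_zero (.of_forall fun y => ?_)
  exact measure_mono_null (t := {‖y‖}) (fun t ht => Eq.symm ht) (by simp)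

/-- The integral of a power of the proper time over an upright causal diamond. -/
lemma setLIntegral_tipDiamond_rpow [Nontrivial E] {s T : ℝ} (hs : 0 ≤ s) (hT : 0 ≤ T) :
    ∫⁻ x in tipDiamond ((T, 0) : ℝ × E), ENNReal.ofReal (minkSq x ^ s) =
      (volume : Measure E).toSphere univ *
        ENNReal.ofReal (diamondMoment (Module.finrank ℝ E - 1) s T) := by
  classical
  have hm : Measurable fun x : ℝ × E => ENNReal.ofReal (minkSq x ^ s) := by
    unfold minkSq
    fun_prop
  let F : ℝ × ℝ → ENNReal := fun x =>
    if x.2 ≤ x.1 ∧ x.2 ≤ T - x.1 then ENNReal.ofReal ((x.1 ^ 2 - x.2 ^ 2) ^ s) else 0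
  have hF : Measurable F := by
    refine Measurable.ite ?_ (by fun_prop) measurable_const
    exact (measurableSet_le measurable_snd measurable_fst).inter
      (measurableSet_le measurable_snd (measurable_const.sub measurable_fst))
  rw [← lintegral_indicator (measurableSet_tipDiamond _), Measure.volume_eq_prod,
    lintegral_prod_symm' _ (hm.indicator (measurableSet_tipDiamond _))]
  have h : ∀ y : E, ∫⁻ t, (tipDiamond ((T, 0) : ℝ × E)).indicator
      (fun x => ENNReal.ofReal (minkSq x ^ s)) (t, y) = ∫⁻ t, F (t, ‖y‖) := by
    intro y
    refine lintegral_congr fun t => ?_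
    simp [F, indicator_apply, tipDiamond, futureCone, minkSq]
  simp_rw [h]
  rw [lintegral_fun_norm_addHaar volume (f := fun r => ∫⁻ t, F (t, r)) hF.lintegral_prod_left',
    ← lintegral_polarIntegrand hs hT, ← lintegral_indicator measurableSet_Ioi]
  congr 1
  refine lintegral_congr fun r => ?_
  by_cases hr : r ∈ Ioi 0
  · have hr0 : 0 < r := hr
    rw [indicator_of_mem hr,
      ← lintegral_const_mul _ (f := fun t => F (t, r)) (hF.comp (by fun_prop))]
    refine lintegral_congr fun t => ?_
    simp only [polarIntegrand, F, hr0, true_and, mul_ite, mul_zero,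
      ENNReal.ofReal_mul (pow_nonneg hr0.le _)]
  · rw [indicator_of_notMem hr]
    have hr0 : ¬ 0 < r := hr
    simp [polarIntegrand, hr0]

lemma volume_tipDiamond_eq [Nontrivial E] {d : ℝ × E} (hd : ‖d.2‖ < d.1) :
    volume (tipDiamond d) = (volume : Measure E).toSphere univ *
      ENNReal.ofReal (diamondMoment (Module.finrank ℝ E - 1) 0 (√(minkSq d))) := by
  rw [volume_tipDiamond hd, ← setLIntegral_tipDiamond_rpow le_rfl (Real.sqrt_nonneg _)]
  simp

/-- The measure of the set of relations in an upright causal diamond. -/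
lemma volume_relations [Nontrivial E] {T : ℝ} (hT : 0 ≤ T) :
    volume {x : (ℝ × E) × (ℝ × E) | x.1 ∈ futureCone E ∧ x.2 - x.1 ∈ futureCone E ∧
        (T, 0) - x.2 ∈ futureCone E} =
      (volume : Measure E).toSphere univ ^ 2 *
        ENNReal.ofReal (diamondMoment (Module.finrank ℝ E - 1) 0 1 *
          diamondMoment (Module.finrank ℝ E - 1) ((Module.finrank ℝ E + 1) / 2) T) := by
  set k := Module.finrank ℝ E - 1 with hk
  have hk' : Module.finrank ℝ E = k + 1 := (Nat.sub_add_cancel Module.finrank_pos).symm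
  have hm : MeasurableSet {x : (ℝ × E) × (ℝ × E) | x.1 ∈ futureCone E ∧
      x.2 - x.1 ∈ futureCone E ∧ (T, 0) - x.2 ∈ futureCone E} := by
    refine ((isClosed_futureCone.preimage ?_).inter
      ((isClosed_futureCone.preimage ?_).inter (isClosed_futureCone.preimage ?_))).measurableSet
    all_goals fun_prop
  have hC : 0 ≤ diamondMoment k 0 1 := (diamondMoment_pos k le_rfl one_pos).le
  have hmq : Measurable fun x : ℝ × E =>
      ENNReal.ofReal (minkSq x ^ (((k + 1 : ℕ) + 1 : ℝ) / 2)) := by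
    unfold minkSq
    fun_prop
  rw [Measure.volume_eq_prod, Measure.prod_apply_symm hm, ENNReal.ofReal_mul hC, hk']
  rw [pow_two, mul_mul_mul_comm, ← setLIntegral_tipDiamond_rpow (by positivity) hT,
    ← lintegral_const_mul _ hmq, ← lintegral_indicator (measurableSet_tipDiamond _)]
  refine lintegral_congr_ae ?_
  filter_upwards [ae_norm_ne_fst] with y hy
  by_cases h : y ∈ tipDiamond ((T, 0) : ℝ × E)
  · have hlt : ‖y.2‖ < y.1 := lt_of_le_of_ne h.1 hy
    rw [indicator_of_mem h]
    have e : (fun x => (x, y)) ⁻¹' {x : (ℝ × E) × (ℝ × E) | x.1 ∈ futureCone E ∧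
      x.2 - x.1 ∈ futureCone E ∧ (T, 0) - x.2 ∈ futureCone E} = tipDiamond y := by
      ext x
      simp [tipDiamond, h.2]
    rw [e, volume_tipDiamond_eq hlt, ← hk, diamondMoment_zero, ENNReal.ofReal_mul hC, mul_assoc]
    congr 3
    rw [Real.sqrt_eq_rpow, ← Real.rpow_natCast, ← Real.rpow_mul (minkSq_nonneg h.1)]
    congr 1
    push_cast
    ring
  · rw [indicator_of_notMem h]
    convert measure_empty (μ := volume)
    refine eq_empty_of_forall_notMem fun x hx => h ⟨?_, hx.2.2⟩
    simpa using add_mem_futureCone hx.1 hx.2.1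

end Minkowski

end CausalDiamond

/-- Myrheim–Meyer flat dimension estimator: the Lebesgue measure (on `ℝ^n × ℝ^n`) of the
set of relations `{(x₁,x₂) : p ⪯ x₁ ⪯ x₂ ⪯ q}`, divided by `V₀²` (where `V₀` is the
Lebesgue volume of `I[p,q]`), equals `𝖿₀(n) = Γ(n+1)Γ(n/2)/(4Γ(3n/2))`, a function of
the dimension `n` alone. -/
theorem stmt9 (n : ℕ) (hn : 2 ≤ n) (T : ℝ) (hT : 0 < T) :
    (volume {x : MinkPt n × MinkPt n |
        causalLE (pDiam n T) x.1 ∧ causalLE x.1 x.2 ∧ causalLE x.2 (qDiam n T)}).toReal /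
        ((volume (diamond n T)).toReal) ^ 2 =
      Real.Gamma ((n : ℝ) + 1) * Real.Gamma ((n : ℝ) / 2) / (4 * Real.Gamma (3 * (n : ℝ) / 2)) := by
  obtain ⟨k, rfl⟩ : ∃ k, n = k + 2 := ⟨n - 2, by omega⟩
  have : Nontrivial (EuclideanSpace ℝ (Fin (k + 2 - 1))) :=
    Module.nontrivial_of_finrank_pos (R := ℝ) (by simp)
  have hfin : Module.finrank ℝ (EuclideanSpace ℝ (Fin (k + 2 - 1))) = k + 1 := by simp
  have hq : ∀ x : MinkPt (k + 2), qDiam (k + 2) T - x = (T, 0) - (-pDiam (k + 2) T + x) := by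
    intro x
    ext1
    · simp only [qDiam, pDiam, Prod.fst_sub, Prod.fst_add, Prod.fst_neg]
      ring
    · simp [qDiam, pDiam]
  have hp : ∀ x : MinkPt (k + 2), x - pDiam (k + 2) T = -pDiam (k + 2) T + x := fun x => by abel
  have hD : diamond (k + 2) T = (-pDiam (k + 2) T + ·) ⁻¹' tipDiamond (T, 0) := by
    ext x
    change x - pDiam (k + 2) T ∈ futureCone _ ∧ qDiam (k + 2) T - x ∈ futureCone _ ↔ _
    rw [hp, hq]
    rfl
  have hR : {x : MinkPt (k + 2) × MinkPt (k + 2) | causalLE (pDiam (k + 2) T) x.1 ∧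
        causalLE x.1 x.2 ∧ causalLE x.2 (qDiam (k + 2) T)} =
      ((-pDiam (k + 2) T, -pDiam (k + 2) T) + ·) ⁻¹'
        {x | x.1 ∈ futureCone _ ∧ x.2 - x.1 ∈ futureCone _ ∧ (T, 0) - x.2 ∈ futureCone _} := by
    ext x
    change x.1 - pDiam (k + 2) T ∈ futureCone _ ∧ x.2 - x.1 ∈ futureCone _ ∧
      qDiam (k + 2) T - x.2 ∈ futureCone _ ↔ _
    rw [hp, hq]
    simp
  have hinv : (volume : Measure (MinkPt (k + 2))).IsAddLeftInvariant :=
    Measure.prod.instIsAddLeftInvariant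
  have hinv' : (volume : Measure (MinkPt (k + 2) × MinkPt (k + 2))).IsAddLeftInvariant :=
    Measure.prod.instIsAddLeftInvariant
  have hV : volume (tipDiamond ((T, 0) : MinkPt (k + 2))) =
      (volume : Measure (EuclideanSpace ℝ (Fin (k + 2 - 1)))).toSphere Set.univ *
        ENNReal.ofReal (diamondMoment k 0 T) := by
    rw [volume_tipDiamond_eq (by simpa using hT), hfin]
    simp [minkSq, Real.sqrt_sq hT.le]
  rw [hD, hR, measure_preimage_add, measure_preimage_add, hV, volume_relations hT.le, hfin,
    ← diamondMoment_ratio k hT]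
  have hA : 0 < ((volume : Measure (EuclideanSpace ℝ (Fin (k + 2 - 1)))).toSphere
      Set.univ).toReal :=
    ENNReal.toReal_pos (Measure.measure_univ_ne_zero.2 (Measure.toSphere_ne_zero _))
      (measure_ne_top _ _)
  have h0 := diamondMoment_pos k le_rfl hT
  have h1 := diamondMoment_pos k le_rfl one_pos
  have h2 : 0 < diamondMoment k (((k + 1 : ℕ) + 1) / 2) T :=
    diamondMoment_pos k (by positivity) hT
  rw [ENNReal.toReal_mul, ENNReal.toReal_mul, ENNReal.toReal_pow, ENNReal.toReal_ofReal h0.le,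
    Nat.add_sub_cancel, ENNReal.toReal_ofReal (by positivity), mul_pow,
    mul_div_mul_left _ _ (by positivity)]
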